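/- Let (G,Ω) be an abundant transitive ℓ-permutation group whose spine 𝔎 has no minimal element, and let Δ ∈ T. Then C²_G(W_h) = rst(Δ) for each h ∈ Q_Δ. In particular, C²_G(W_h) = C²_G(W_{h'}) for all h,h' ∈ Q_Δ. -/

import Mathlib

/-!  Common framework for ℓ-permutation groups on a totally ordered set. -/

namespace LPerm

variable {Ω : Type*} [LinearOrder Ω]

/-- Pointwise join of two order automorphisms of a totally ordered set. -/
def autSup (f g : Ω ≃o Ω) : Ω ≃o Ω :=
  Equiv.toOrderIso
    { toFun := fun α => max (f α) (g α)
      invFun := fun α => min (f.symm α) (g.symm α)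
      left_inv := by
        intro α
        dsimp only
        rcases le_total (f α) (g α) with h | h
        · rw [max_eq_right h]
          have h1 : α ≤ f.symm (g α) := by
            have := f.symm.monotone h
            simpa using this
          rw [g.symm_apply_apply, min_eq_right h1]
        · rw [max_eq_left h]
          have h1 : α ≤ g.symm (f α) := by
            have := g.symm.monotone h
            simpa using this
          rw [f.symm_apply_apply, min_eq_left h1]
      right_inv := by
        intro α
        dsimp only
        rcases le_total (f.symm α) (g.symm α) with h | h
        · rw [min_eq_left h]
          have h1 : g (f.symm α) ≤ α := by
            have := g.monotone h
            simpa using this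
          rw [f.apply_symm_apply, max_eq_left h1]
        · rw [min_eq_right h]
          have h1 : f (g.symm α) ≤ α := by
            have := f.monotone h
            simpa using this
          rw [g.apply_symm_apply, max_eq_right h1] }
    (f.monotone.max g.monotone)
    (f.symm.monotone.min g.symm.monotone)

/-- Pointwise meet of two order automorphisms of a totally ordered set. -/
def autInf (f g : Ω ≃o Ω) : Ω ≃o Ω :=
  Equiv.toOrderIso
    { toFun := fun α => min (f α) (g α)
      invFun := fun α => max (f.symm α) (g.symm α)
      left_inv := by
        intro α
        dsimp only
        rcases le_total (f α) (g α) with h | h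
        · rw [min_eq_left h]
          have h1 : g.symm (f α) ≤ α := by
            have := g.symm.monotone h
            simpa using this
          rw [f.symm_apply_apply, max_eq_left h1]
        · rw [min_eq_right h]
          have h1 : f.symm (g α) ≤ α := by
            have := f.symm.monotone h
            simpa using this
          rw [g.symm_apply_apply, max_eq_right h1]
      right_inv := by
        intro α
        dsimp only
        rcases le_total (f.symm α) (g.symm α) with h | h
        · rw [max_eq_right h]
          have h1 : α ≤ f (g.symm α) := by
            have := f.monotone h
            simpa using this
          rw [g.apply_symm_apply, min_eq_right h1]
        · rw [max_eq_left h]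
          have h1 : α ≤ g (f.symm α) := by
            have := g.monotone h
            simpa using this
          rw [f.apply_symm_apply, min_eq_left h1] }
    (f.monotone.min g.monotone)
    (f.symm.monotone.max g.symm.monotone)


/-- The pointwise order on order automorphisms: `f ≤ g` iff `f α ≤ g α` for all `α`. -/
def autLe (f g : Ω ≃o Ω) : Prop := ∀ α : Ω, f α ≤ g α

/-- `|g| = g ∨ g⁻¹`. -/
def autAbs (g : Ω ≃o Ω) : Ω ≃o Ω := autSup g g⁻¹

/-- The support of an automorphism. -/
def supp (g : Ω ≃o Ω) : Set Ω := {α | g α ≠ α}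

/-- Conjugation, written `h^g = g⁻¹ h g` in the paper. -/
def aconj (h g : Ω ≃o Ω) : Ω ≃o Ω := g⁻¹ * h * g

/-- The commutator `[a,b] = a⁻¹ b⁻¹ a b`. -/
def pcomm (a b : Ω ≃o Ω) : Ω ≃o Ω := a⁻¹ * b⁻¹ * a * b

/-- `G` is closed under the pointwise lattice operations, i.e. `(G,Ω)` is an
ℓ-permutation group. -/
def SublatticeClosed (G : Subgroup (Ω ≃o Ω)) : Prop :=
  ∀ f g : Ω ≃o Ω, f ∈ G → g ∈ G → autSup f g ∈ G ∧ autInf f g ∈ G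

/-- `(G,Ω)` is transitive. -/
def IsTransitive (G : Subgroup (Ω ≃o Ω)) : Prop :=
  ∀ α β : Ω, ∃ g ∈ G, g α = β

/-- `(G,Ω)` is o-2 transitive. -/
def IsO2Transitive (G : Subgroup (Ω ≃o Ω)) : Prop :=
  ∀ α₁ α₂ β₁ β₂ : Ω, α₁ < α₂ → β₁ < β₂ → ∃ g ∈ G, g α₁ = β₁ ∧ g α₂ = β₂

/-- A convex `G`-congruence: an equivalence relation with convex classes which is
preserved by the action of `G`. -/
def IsConvexCongruence (G : Subgroup (Ω ≃o Ω)) (r : Ω → Ω → Prop) : Prop :=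
  Equivalence r ∧ (∀ α β γ : Ω, r α γ → α ≤ β → β ≤ γ → r α β) ∧
    ∀ g ∈ G, ∀ α β : Ω, r α β → r (g α) (g β)

/-- `V(α,β)`: the intersection of all convex `G`-congruences under which `α` and `β`
are equivalent. -/
def Vcong (G : Subgroup (Ω ≃o Ω)) (α β : Ω) : Ω → Ω → Prop :=
  fun γ δ => ∀ r : Ω → Ω → Prop, IsConvexCongruence G r → r α β → r γ δ

/-- Membership in the spine `𝔎` of `(G,Ω)`. -/
def SpineMem (G : Subgroup (Ω ≃o Ω)) (r : Ω → Ω → Prop) : Prop :=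
  ∃ α β : Ω, α ≠ β ∧ r = Vcong G α β

/-- Inclusion of relations. -/
def relLe (r s : Ω → Ω → Prop) : Prop := ∀ x y : Ω, r x y → s x y

/-- `Δ ∈ T`: `Δ` is an o-block (class) of a member of the spine `𝔎`. -/
def InT (G : Subgroup (Ω ≃o Ω)) (Δ : Set Ω) : Prop :=
  ∃ r : Ω → Ω → Prop, SpineMem G r ∧ ∃ δ : Ω, Δ = {γ | r δ γ}

/-- `Δ` is a class (o-block) of the relation `r`. -/
def IsBlockOf (r : Ω → Ω → Prop) (Δ : Set Ω) : Prop :=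
  ∃ δ : Ω, Δ = {γ | r δ γ}

/-- The restricted stabiliser `rst(S) = {g ∈ G ∣ supp g ⊆ S}`. -/
def rst (G : Subgroup (Ω ≃o Ω)) (S : Set Ω) : Set (Ω ≃o Ω) :=
  {g | g ∈ G ∧ supp g ⊆ S}

/-- The (setwise) stabiliser `st(Δ) = {g ∈ G ∣ Δg = Δ}`. -/
def stab (G : Subgroup (Ω ≃o Ω)) (Δ : Set Ω) : Set (Ω ≃o Ω) :=
  {g | g ∈ G ∧ g '' Δ = Δ}

/-- `Q_Δ = {h ∈ rst(Δ) ∣ ∃ α ∈ Δ, V(α, αh) = κ(Δ)}`; since `κ(Δ)` is the unique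
convex congruence having `Δ` as a class, the condition `V(α,αh) = κ(Δ)` says exactly
that `Δ` is the class of `V(α, αh)` containing `α`. -/
def Qset (G : Subgroup (Ω ≃o Ω)) (Δ : Set Ω) : Set (Ω ≃o Ω) :=
  {h | h ∈ rst G Δ ∧ ∃ α ∈ Δ, Δ = {γ | Vcong G α (h α) α γ}}

/-- `(G,Ω)` is ample: `Q_Δ ≠ ∅` for every `Δ ∈ T`. -/
def Ample (G : Subgroup (Ω ≃o Ω)) : Prop :=
  ∀ Δ : Set Ω, InT G Δ → (Qset G Δ).Nonempty

/-- `(G,Ω)` is abundant: for every `Δ ∈ T` and `g ∈ st(Δ)`, the automorphism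
`dep(g,Δ)` agreeing with `g` on `Δ` and with the identity elsewhere lies in `G`. -/
def Abundant (G : Subgroup (Ω ≃o Ω)) : Prop :=
  ∀ Δ : Set Ω, InT G Δ → ∀ g ∈ stab G Δ,
    ∃ g₀ ∈ G, (∀ α ∈ Δ, g₀ α = g α) ∧ ∀ α ∉ Δ, g₀ α = α

/-- The spine `𝔎` has no minimal element. -/
def SpineNoMin (G : Subgroup (Ω ≃o Ω)) : Prop :=
  ∀ r : Ω → Ω → Prop, SpineMem G r →
    ∃ r' : Ω → Ω → Prop, SpineMem G r' ∧ relLe r' r ∧ r' ≠ r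

/-- `Δ` is a minimal element of `T`. -/
def MinimalInT (G : Subgroup (Ω ≃o Ω)) (Δ : Set Ω) : Prop :=
  InT G Δ ∧ ∀ Δ' : Set Ω, InT G Δ' → Δ' ⊆ Δ → Δ' = Δ

/-- Hypothesis (†): if `T` has a minimal element `Δ₀`, then every (nondegenerate
bounded) interval of `Δ₀` supports a non-trivial element of `G`. -/
def Dagger (G : Subgroup (Ω ≃o Ω)) : Prop :=
  ∀ Δ₀ : Set Ω, MinimalInT G Δ₀ → ∀ α β : Ω, α ∈ Δ₀ → β ∈ Δ₀ → α < β →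
    ∃ g : Ω ≃o Ω, g ∈ G ∧ g ≠ 1 ∧ supp g ⊆ Set.Ioo α β

/-- `X_h = {[h⁻¹, h^g] ∣ g ∈ G}`. -/
def Xset (G : Subgroup (Ω ≃o Ω)) (h : Ω ≃o Ω) : Set (Ω ≃o Ω) :=
  {x | ∃ g ∈ G, x = pcomm h⁻¹ (aconj h g)}

/-- `W_h = ⋃ {X_{h^g} ∣ g ∈ G, [X_h, X_{h^g}] ≠ 1}`. -/
def Wset (G : Subgroup (Ω ≃o Ω)) (h : Ω ≃o Ω) : Set (Ω ≃o Ω) :=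
  {x | ∃ g ∈ G, (∃ a ∈ Xset G h, ∃ b ∈ Xset G (aconj h g), pcomm a b ≠ 1) ∧
    x ∈ Xset G (aconj h g)}

/-- The centraliser of a subset `S` in `G`. -/
def cent (G : Subgroup (Ω ≃o Ω)) (S : Set (Ω ≃o Ω)) : Set (Ω ≃o Ω) :=
  {f | f ∈ G ∧ ∀ s ∈ S, s * f = f * s}

/-- The double centraliser of a subset `S` in `G`. -/
def cent2 (G : Subgroup (Ω ≃o Ω)) (S : Set (Ω ≃o Ω)) : Set (Ω ≃o Ω) :=
  cent G (cent G S)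

/-- The pointwise stabiliser in `G` of a subset `S ⊆ Ω`. -/
def ptStab (G : Subgroup (Ω ≃o Ω)) (S : Set Ω) : Set (Ω ≃o Ω) :=
  {f | f ∈ G ∧ ∀ α ∈ S, f α = α}

/-- The congruence covered by `K`: the union of all convex `G`-congruences properly
contained in `K`. -/
def coveredRel (G : Subgroup (Ω ≃o Ω)) (K : Ω → Ω → Prop) : Ω → Ω → Prop :=
  fun γ δ => ∃ r : Ω → Ω → Prop, IsConvexCongruence G r ∧ relLe r K ∧ r ≠ K ∧ r γ δ

/-- `Γ ∈ π(Δ)`, where `K = κ(Δ)`: `Γ` is a class of the congruence covered by `K`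
contained in `Δ`. -/
def InPi (G : Subgroup (Ω ≃o Ω)) (K : Ω → Ω → Prop) (Δ Γ : Set Ω) : Prop :=
  ∃ δ ∈ Δ, Γ = {γ | coveredRel G K δ γ}

/-- An irreducible element of `G`. -/
def IsIrreducibleElt (G : Subgroup (Ω ≃o Ω)) (g : Ω ≃o Ω) : Prop :=
  autLe 1 g ∧ g ≠ 1 ∧
    ∀ g₁ g₂ : Ω ≃o Ω, g₁ ∈ G → g₂ ∈ G → autSup g₁ g₂ = g → autInf g₁ g₂ = 1 →
      g₁ = 1 ∨ g₂ = 1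

/-- `(G,Ω)` is controlled. -/
def Controlled (G : Subgroup (Ω ≃o Ω)) : Prop :=
  ∀ Δ : Set Ω, InT G Δ → ¬ MinimalInT G Δ → ∀ g ∈ rst G Δ,
    (∃ δ ∈ Δ ∩ supp g, Δ = {γ | Vcong G δ (g δ) δ γ}) ∨
      ∃ Δ' : Set Ω, InT G Δ' ∧ supp g ⊆ Δ' ∧ Δ' ⊂ Δ



section ConvexCongruences

variable {G : Subgroup (Ω ≃o Ω)}

theorem isConvexCongruence_eq : IsConvexCongruence G (Eq : Ω → Ω → Prop) := by
  refine ⟨eq_equivalence, ?_, ?_⟩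
  · rintro α β γ rfl h₁ h₂
    exact le_antisymm h₁ h₂
  · rintro g - α β rfl
    rfl

theorem isConvexCongruence_Vcong (α β : Ω) : IsConvexCongruence G (Vcong G α β) := by
  refine ⟨⟨fun x r hr _ => hr.1.refl x, fun h r hr hab => hr.1.symm (h r hr hab),
    fun h₁ h₂ r hr hab => hr.1.trans (h₁ r hr hab) (h₂ r hr hab)⟩, ?_, ?_⟩
  · intro x y z h hxy hyz r hr hab
    exact hr.2.1 x y z (h r hr hab) hxy hyz
  · intro g hg x y h r hr hab
    exact hr.2.2 g hg x y (h r hr hab)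

theorem Vcong_self_pair (α β : Ω) : Vcong G α β α β := fun _ _ h => h

theorem SpineMem.isConvexCongruence {c : Ω → Ω → Prop} (hc : SpineMem G c) :
    IsConvexCongruence G c := by
  obtain ⟨a, b, -, rfl⟩ := hc
  exact isConvexCongruence_Vcong a b

theorem IsConvexCongruence.apply_iff {c : Ω → Ω → Prop} (hc : IsConvexCongruence G c)
    {g : Ω ≃o Ω} (hg : g ∈ G) (x y : Ω) : c (g x) (g y) ↔ c x y := by
  refine ⟨fun h => ?_, hc.2.2 g hg x y⟩
  simpa using hc.2.2 g⁻¹ (G.inv_mem hg) _ _ h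

/-- Convex congruences of a transitive group form a chain. -/
theorem IsConvexCongruence.le_of_not_rel (htrans : IsTransitive G) {c d : Ω → Ω → Prop}
    (hc : IsConvexCongruence G c) (hd : IsConvexCongruence G d) {x y : Ω}
    (hcxy : c x y) (hdxy : ¬ d x y) : relLe d c := by
  wlog hlt : x < y generalizing x y
  · refine this (hc.1.symm hcxy) (fun h => hdxy (hd.1.symm h)) ?_
    refine lt_of_le_of_ne (not_lt.mp hlt) ?_
    rintro rfl
    exact hdxy (hd.1.refl _)
  have up : ∀ z, x ≤ z → d x z → c x z := by
    intro z hxz hz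
    refine hc.2.1 x z y hcxy hxz (le_of_lt (not_le.mp fun hyz => hdxy ?_))
    exact hd.2.1 x y z hz hlt.le hyz
  have all : ∀ z, d x z → c x z := by
    intro z hz
    rcases le_total x z with hxz | hzx
    · exact up z hxz hz
    · obtain ⟨g, hg, hgz⟩ := htrans z x
      have h1 : d x (g x) := by
        have := hd.2.2 g hg _ _ (hd.1.symm hz)
        rwa [hgz] at this
      have h2 : x ≤ g x := by
        have := g.monotone hzx
        rwa [hgz] at this
      have h3 := up _ h2 h1
      rw [← hgz, hc.apply_iff hg, hgz] at h3
      exact hc.1.symm h3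
  intro u v huv
  obtain ⟨g, hg, hgu⟩ := htrans u x
  rw [← hc.apply_iff hg, hgu]
  apply all
  rwa [← hgu, hd.apply_iff hg]

theorem relLe_total (htrans : IsTransitive G) {c d : Ω → Ω → Prop}
    (hc : IsConvexCongruence G c) (hd : IsConvexCongruence G d) : relLe c d ∨ relLe d c := by
  by_cases h : relLe c d
  · exact Or.inl h
  · unfold relLe at h
    push Not at h
    obtain ⟨x, y, h₁, h₂⟩ := h
    exact Or.inr (hc.le_of_not_rel htrans hd h₁ h₂)

theorem exists_spineMem_le_le (htrans : IsTransitive G) {c d : Ω → Ω → Prop}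
    (hc : SpineMem G c) (hd : SpineMem G d) :
    ∃ e, SpineMem G e ∧ relLe e c ∧ relLe e d := by
  rcases relLe_total htrans hc.isConvexCongruence hd.isConvexCongruence with h | h
  · exact ⟨c, hc, fun _ _ h => h, h⟩
  · exact ⟨d, hd, h, fun _ _ h => h⟩

theorem exists_spineMem_not_rel (hnomin : SpineNoMin G) {β γ : Ω} (h : β ≠ γ) :
    ∃ c, SpineMem G c ∧ ¬ c β γ := by
  obtain ⟨c, hc, hle, hne⟩ := hnomin (Vcong G β γ) ⟨β, γ, h, rfl⟩
  refine ⟨c, hc, fun hrel => hne ?_⟩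
  funext x y
  exact propext ⟨hle x y, fun hxy => hxy c hc.isConvexCongruence hrel⟩

theorem SpineMem.exists_ne_rel (htrans : IsTransitive G) {c : Ω → Ω → Prop}
    (hc : SpineMem G c) (β : Ω) : ∃ γ, γ ≠ β ∧ c β γ := by
  have hcc := hc.isConvexCongruence
  obtain ⟨a, b, hab, rfl⟩ := hc
  obtain ⟨g, hg, rfl⟩ := htrans a β
  exact ⟨g b, fun H => hab (g.injective H).symm, hcc.2.2 g hg _ _ (Vcong_self_pair a b)⟩

/-- Every block of the spine supports an element of `G` moving a prescribed point of it. -/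
theorem exists_mem_move (htrans : IsTransitive G) (habund : Abundant G)
    {c : Ω → Ω → Prop} (hc : SpineMem G c) (β : Ω) :
    ∃ k ∈ G, k β ≠ β ∧ ∀ z, ¬ c β z → k z = z := by
  have hcc := hc.isConvexCongruence
  obtain ⟨γ, hne, hγ⟩ := hc.exists_ne_rel htrans β
  obtain ⟨g, hg, rfl⟩ := htrans β γ
  have hst : g ∈ stab G {z | c β z} := by
    refine ⟨hg, Set.Subset.antisymm ?_ ?_⟩
    · rintro _ ⟨z, hz, rfl⟩
      exact hcc.1.trans hγ (hcc.2.2 g hg _ _ hz)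
    · intro z hz
      refine ⟨g⁻¹ z, ?_, by simp⟩
      change c β (g⁻¹ z)
      rw [← hcc.apply_iff hg]
      simpa using hcc.1.trans (hcc.1.symm hγ) hz
  obtain ⟨k, hk, hk₁, hk₂⟩ := habund _ ⟨c, hc, β, rfl⟩ g hst
  refine ⟨k, hk, ?_, hk₂⟩
  rw [hk₁ β (hcc.1.refl β)]
  exact hne

end ConvexCongruences

theorem mul_comm_of_disjoint_supp {f x : Ω ≃o Ω} (h : ∀ z, f z = z ∨ x z = z) :
    f * x = x * f := by
  ext z
  simp only [RelIso.mul_apply]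
  by_cases hx : x z = z
  · by_cases hf : f z = z
    · rw [hx, hf, hx]
    · have : f (f z) ≠ f z := fun h' => hf (f.injective h')
      rw [hx, (h (f z)).resolve_left this]
  · have hf := (h z).resolve_right hx
    have : x (x z) ≠ x z := fun h' => hx (x.injective h')
    rw [hf, (h (x z)).resolve_right this]

theorem apply_apply_ne {k : Ω ≃o Ω} {β : Ω} (h : k β ≠ β) : k (k β) ≠ β := by
  rcases lt_or_gt_of_ne h with h | h
  · exact ((k.strictMono h).trans h).ne
  · exact (h.trans (k.strictMono h)).ne'

theorem aconj_apply (h g : Ω ≃o Ω) (z : Ω) : aconj h g z = g⁻¹ (h (g z)) := rfl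

theorem pcomm_ne_one_of_mul_ne {a b : Ω ≃o Ω} (h : a * b ≠ b * a) : pcomm a b ≠ 1 := by
  intro h'
  apply h
  have : b * a * pcomm a b = a * b := by unfold pcomm; group
  rw [← this, h', mul_one]

theorem pcomm_eq_one_of_mul_eq {a b : Ω ≃o Ω} (h : a * b = b * a) : pcomm a b = 1 := by
  have : pcomm a b = (b * a)⁻¹ * (a * b) := by unfold pcomm; group
  rw [this, h, inv_mul_cancel]

section Commutators

variable {G : Subgroup (Ω ≃o Ω)}

/-- Near a point `β` moved by `h`, the set `X_h` contains elements moving `β`, `hβ`, `h⁻¹β`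
and fixing any prescribed fourth point. -/
theorem exists_mem_Xset_move (htrans : IsTransitive G) (habund : Abundant G)
    (hnomin : SpineNoMin G) {h : Ω ≃o Ω} {β : Ω} (hβ : h β ≠ β)
    {q : Ω} (hq₀ : q ≠ β) (hq₁ : q ≠ h β) (hq₂ : q ≠ h⁻¹ β) (hh : h ∈ G) :
    ∃ y ∈ Xset G h, y β ≠ β ∧ y (h β) ≠ h β ∧ y (h⁻¹ β) ≠ h⁻¹ β ∧ y q = q := by
  obtain ⟨c₁, hc₁, hr₁⟩ := exists_spineMem_not_rel hnomin hβ.symm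
  obtain ⟨c₂, hc₂, hr₂⟩ := exists_spineMem_not_rel hnomin hq₀.symm
  obtain ⟨c₃, hc₃, hr₃⟩ := exists_spineMem_not_rel hnomin (β := β) (γ := h q)
    (by rintro rfl; simp at hq₂)
  obtain ⟨c₄, hc₄, hr₄⟩ := exists_spineMem_not_rel hnomin (β := β) (γ := h⁻¹ q)
    (by rintro rfl; simp at hq₁)
  obtain ⟨c₅, hc₅, h51, h52⟩ := exists_spineMem_le_le htrans hc₁ hc₂
  obtain ⟨c₆, hc₆, h63, h64⟩ := exists_spineMem_le_le htrans hc₃ hc₄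
  obtain ⟨c, hc, h5, h6⟩ := exists_spineMem_le_le htrans hc₅ hc₆
  have hcc := hc.isConvexCongruence
  have hd : ¬ c β (h β) := fun H => hr₁ (h51 _ _ (h5 _ _ H))
  have d0 : ¬ c β q := fun H => hr₂ (h52 _ _ (h5 _ _ H))
  have d1 : ¬ c β (h q) := fun H => hr₃ (h63 _ _ (h6 _ _ H))
  have d2 : ¬ c β (h⁻¹ q) := fun H => hr₄ (h64 _ _ (h6 _ _ H))
  have m1 : ∀ z, c β z → ¬ c β (h z) := fun z hz hhz =>
    hd (hcc.1.trans hhz (hcc.1.symm (hcc.2.2 h hh _ _ hz)))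
  have m2 : ∀ z, c β z → ¬ c β (h⁻¹ z) := fun z hz hhz =>
    m1 _ hhz (by simpa using hz)
  have mm1 : ∀ z, c β z → ¬ c β (h (h z)) := by
    intro z hz hhz
    apply m1 z hz
    rcases le_total z (h z) with hle | hle
    · exact hcc.1.trans hz (hcc.2.1 _ _ _ (hcc.1.trans (hcc.1.symm hz) hhz) hle (h.monotone hle))
    · exact hcc.1.trans hhz
        (hcc.2.1 _ _ _ (hcc.1.trans (hcc.1.symm hhz) hz) (h.monotone hle) hle)
  have mm2 : ∀ z, c β z → ¬ c β (h⁻¹ (h⁻¹ z)) := fun z hz hhz =>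
    mm1 _ hhz (by simpa using hz)
  obtain ⟨k, hk, hkβ, hkfix⟩ := exists_mem_move htrans habund hc β
  have hkfix' : ∀ z, ¬ c β z → k⁻¹ z = z := fun z hz => by
    conv_lhs => rw [← hkfix z hz]
    simp
  have hkmem : ∀ z, c β z → c β (k z) := by
    intro z hz
    by_contra hcon
    have := hkfix _ hcon
    rw [k.injective this] at hcon
    exact hcon hz
  have hkmem' : ∀ z, c β z → c β (k⁻¹ z) := by
    intro z hz
    by_contra hcon
    have := hkfix' _ hcon
    rw [k⁻¹.injective this] at hcon
    exact hcon hz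
  have hkβ' : k⁻¹ β ≠ β := fun H => hkβ (by conv_lhs => rw [← H]; simp)
  have hββ := hcc.1.refl β
  have formula : ∀ z, pcomm h⁻¹ (aconj h k) z
      = h (k⁻¹ (h⁻¹ (k (h⁻¹ (k⁻¹ (h (k z))))))) := by
    intro z
    simp [pcomm, aconj, mul_assoc]
  refine ⟨pcomm h⁻¹ (aconj h k), ⟨k, hk, rfl⟩, ?_, ?_, ?_, ?_⟩
  · have hkk := hkmem _ hββ
    rw [formula, hkfix' _ (m1 _ hkk), RelIso.inv_apply_self, hkfix' _ (m2 _ (hkmem _ hkk)),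
      RelIso.apply_inv_self]
    exact apply_apply_ne hkβ
  · rw [formula, hkfix _ (m1 _ hββ), hkfix' _ (mm1 _ hββ), RelIso.inv_apply_self,
      hkfix _ (m1 _ hββ), RelIso.inv_apply_self]
    exact fun H => hkβ' (h.injective H)
  · have hkk := hkmem' _ hββ
    rw [formula, hkfix _ (m2 _ hββ), RelIso.apply_inv_self, hkfix _ (m2 _ hkk),
      hkfix' _ (mm2 _ hkk), RelIso.apply_inv_self]
    exact fun H => hkβ' (h⁻¹.injective H)
  · rw [formula, hkfix _ d0, hkfix' _ d1, RelIso.inv_apply_self, hkfix _ d0, hkfix' _ d2,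
      RelIso.apply_inv_self]

/-- An automorphism commuting with `X_h` fixes every point moved by `h`. -/
theorem fixes_of_commute_Xset (htrans : IsTransitive G) (habund : Abundant G)
    (hnomin : SpineNoMin G) {h : Ω ≃o Ω} (hh : h ∈ G) {β : Ω} (hβ : h β ≠ β)
    {x : Ω ≃o Ω} (hx : ∀ y ∈ Xset G h, y * x = x * y) : x β = β := by
  have key : ∀ p, p = β ∨ p = h β ∨ p = h⁻¹ β → x p = β ∨ x p = h β ∨ x p = h⁻¹ β := by
    intro p hp
    by_contra! hcon
    obtain ⟨y, hy, h0, h1, h2, hfix⟩ := exists_mem_Xset_move htrans habund hnomin hβ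
      hcon.1 hcon.2.1 hcon.2.2 hh
    have hyp : y p ≠ p := by rcases hp with rfl | rfl | rfl <;> assumption
    have := DFunLike.congr_fun (hx y hy) p
    simp only [RelIso.mul_apply, hfix] at this
    exact hyp (x.injective this).symm
  have k0 := key β (by simp)
  have k1 := key (h β) (by simp)
  have k2 := key (h⁻¹ β) (by simp)
  rcases lt_or_gt_of_ne hβ with hlt | hlt
  · have h' : β < h⁻¹ β := by simpa using h⁻¹.strictMono hlt
    have i1 := x.strictMono hlt
    have i2 := x.strictMono h'
    rcases k0 with k0 | k0 | k0
    · exact k0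
    · rcases k1 with k1 | k1 | k1 <;> rw [k0, k1] at i1 <;> order
    · rcases k2 with k2 | k2 | k2 <;> rw [k0, k2] at i2 <;> order
  · have h' : h⁻¹ β < β := by simpa using h⁻¹.strictMono hlt
    have i1 := x.strictMono hlt
    have i2 := x.strictMono h'
    rcases k0 with k0 | k0 | k0
    · exact k0
    · rcases k1 with k1 | k1 | k1 <;> rw [k0, k1] at i1 <;> order
    · rcases k2 with k2 | k2 | k2 <;> rw [k0, k2] at i2 <;> order

end Commutators

section Interpolation

variable {G : Subgroup (Ω ≃o Ω)}

/-- A monotone equivariant set-valued map induces a convex congruence. -/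
theorem isConvexCongruence_of_equivariant {F : Ω → Set Ω} (hmono : Monotone F)
    (hF : ∀ g ∈ G, ∀ y, ∀ z ∈ F y, g z ∈ F (g y)) :
    IsConvexCongruence G (fun y y' => F y = F y') := by
  have hsub : ∀ g ∈ G, ∀ y y', F y = F y' → F (g y) ⊆ F (g y') := by
    intro g hg y y' h z hz
    have h1 := hF g⁻¹ (G.inv_mem hg) _ z hz
    rw [RelIso.inv_apply_self, h] at h1
    simpa using hF g hg _ _ h1
  refine ⟨⟨fun _ => rfl, Eq.symm, Eq.trans⟩, ?_, ?_⟩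
  · intro a b c hac hab hbc
    exact Set.Subset.antisymm (hmono hab) ((hmono hbc).trans_eq hac.symm)
  · intro g hg a b hab
    exact Set.Subset.antisymm (hsub g hg _ _ hab) (hsub g hg _ _ hab.symm)

theorem autSup_apply (f g : Ω ≃o Ω) (x : Ω) : autSup f g x = max (f x) (g x) := rfl

theorem autInf_apply (f g : Ω ≃o Ω) (x : Ω) : autInf f g x = min (f x) (g x) := rfl

/-- A convex congruence is the kernel of a monotone map to a linear order. -/
theorem IsConvexCongruence.exists_monotone {r : Ω → Ω → Prop} (hr : IsConvexCongruence G r) :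
    ∃ π : Ω → LowerSet Ω, Monotone π ∧ ∀ x y, π x = π y ↔ r x y := by
  have low : ∀ x, IsLowerSet {z | z ≤ x ∨ r x z} := by
    rintro x z z' hz (h | h)
    · exact Or.inl (hz.trans h)
    · rcases le_total z' x with h' | h'
      · exact Or.inl h'
      · exact Or.inr (hr.2.1 x z' z h h' hz)
  refine ⟨fun x => ⟨_, low x⟩, ?_, ?_⟩
  · intro x y hxy z hz
    change z ≤ y ∨ r y z
    rcases hz with h | h
    · exact Or.inl (h.trans hxy)
    · rcases le_total z y with h' | h'
      · exact Or.inl h'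
      · exact Or.inr (hr.1.trans (hr.1.symm (hr.2.1 x y z h hxy h')) h)
  · intro x y
    constructor
    · intro h
      have h1 : x ≤ y ∨ r y x := h.le (Or.inl le_rfl)
      have h2 : y ≤ x ∨ r x y := h.ge (Or.inl le_rfl)
      rcases h1 with h1 | h1
      · rcases h2 with h2 | h2
        · rw [le_antisymm h1 h2]
          exact hr.1.refl y
        · exact h2
      · exact hr.1.symm h1
    · intro h
      have sub : ∀ x y, r x y → ∀ z, z ≤ x ∨ r x z → z ≤ y ∨ r y z := by
        rintro x y h z (hz | hz)
        · rcases le_total z y with h' | h'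
          · exact Or.inl h'
          · exact Or.inr (hr.2.1 y z x (hr.1.symm h) h' hz)
        · exact Or.inr (hr.1.trans (hr.1.symm h) hz)
      ext z
      exact ⟨sub x y h z, sub y x (hr.1.symm h) z⟩

/-- If `h` and its conjugate by `t` have disjoint supports modulo the kernel of `π`, and the
action modulo that kernel is primitive near `α`, then some translate of `(α, hα)` goes from the
support of `h` to the orbit of `tα`. -/
theorem exists_translate_between {Λ : Type*} [LinearOrder Λ] (hlat : SublatticeClosed G)
    (htrans : IsTransitive G) {π : Ω → Λ} (hπ : Monotone π)
    (hinv : ∀ g ∈ G, ∀ x y, π x = π y → π (g x) = π (g y))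
    {h t : Ω ≃o Ω} (hh : h ∈ G) (ht : t ∈ G) {α : Ω}
    (hα : π α < π (h α)) (htα : π α < π (t α))
    (hprim : ∀ c, IsConvexCongruence G c → ∀ x y, π x ≠ π y → c x y → c α (t α))
    (hdisj : ∀ x, π (h x) ≠ π x → π (t (h (t⁻¹ x))) = π x) :
    ∃ u ∈ G, π (h (u α)) ≠ π (u α) ∧ π (u (h α)) = π (t (h α)) := by
  by_contra! hneg
  have hlt : ∀ g ∈ G, ∀ {x y}, π x < π y → π (g x) < π (g y) := by
    intro g hg x y hxy
    refine lt_of_le_of_ne (hπ (g.monotone (hπ.reflect_lt hxy).le)) fun H => hxy.ne ?_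
    simpa using hinv g⁻¹ (G.inv_mem hg) _ _ H
  have hle : ∀ g ∈ G, ∀ {x y}, π x ≤ π y → π (g x) ≤ π (g y) := by
    intro g hg x y hxy
    rcases hxy.lt_or_eq with H | H
    · exact (hlt g hg H).le
    · exact (hinv g hg _ _ H).le
  have hS : ∀ {x y}, π x = π y → π (h x) ≠ π x → π (h y) ≠ π y := by
    intro x y hxy hx hy
    exact hx (by rw [hinv h hh _ _ hxy, hy, hxy])
  have hq : π (t α) < π (t (h α)) := hlt t ht hα
  -- translates of `(α, hα)` starting in the support below `tα` end below `t h α`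
  have bound : ∀ s, π (h s) ≠ π s → π s < π (t α) → ∀ u ∈ G, π (u α) ≤ π s →
      π (u (h α)) < π (t (h α)) := by
    intro s hs hst u hu hus
    by_contra! hcon
    obtain ⟨c, hc, rfl⟩ := htrans α s
    have hv := (hlat _ t (hlat u c hu hc).1 ht).2
    have e1 : π (autInf (autSup u c) t α) = π (c α) := by
      rw [autInf_apply, autSup_apply, hπ.map_min, hπ.map_max, max_eq_right hus,
        min_eq_left hst.le]
    refine hneg _ hv (hS e1.symm hs) ?_
    rw [autInf_apply, autSup_apply, hπ.map_min, hπ.map_max]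
    exact min_eq_right (hcon.trans (le_max_left _ _))
  let D : Ω → Set Ω := fun y => {z | ∃ u ∈ G, π (u α) ≤ π y ∧ π z ≤ π (u (h α))}
  have Dmono : ∀ {y y'}, π y ≤ π y' → D y ⊆ D y' := by
    rintro y y' hy z ⟨u, hu, h1, h2⟩
    exact ⟨u, hu, h1.trans hy, h2⟩
  have Dequi : ∀ g ∈ G, ∀ y, ∀ z ∈ D y, g z ∈ D (g y) := by
    rintro g hg y z ⟨u, hu, h1, h2⟩
    exact ⟨g * u, G.mul_mem hg hu, hle g hg h1, hle g hg h2⟩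
  have hDc : IsConvexCongruence G (fun y y' => D y = D y') :=
    isConvexCongruence_of_equivariant (fun _ _ H => Dmono (hπ H)) Dequi
  have Dinj : ∀ x y, D x = D y → π x = π y := by
    intro x y hxy
    by_contra hne
    have hD := hprim _ hDc x y hne hxy
    have hm : t (h α) ∈ D (t α) := ⟨t, ht, le_rfl, le_rfl⟩
    rw [← hD] at hm
    obtain ⟨u, hu, h1, h2⟩ := hm
    exact (bound α hα.ne' htα u hu h1).not_ge h2
  have htfix : π (h (t α)) = π (t α) := by
    by_contra hne
    have := hdisj _ hne
    rw [RelIso.inv_apply_self] at this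
    exact hq.ne' this
  let L : Set Ω := {y | ∃ s, π (h s) ≠ π s ∧ π s < π (t α) ∧ π y ≤ π s}
  have Lclosed : ∀ y ∈ L, D y ⊆ L := by
    rintro y ⟨s, hs, hst, hys⟩ p hp
    replace hp := Dmono hys hp
    obtain ⟨e, he, hse, heS⟩ : ∃ e ∈ G, π s < π (e s) ∧ ∀ x, π (e x) = π x ↔ π (h x) = π x := by
      rcases lt_or_gt_of_ne hs with H | H
      · refine ⟨h⁻¹, G.inv_mem hh, by simpa using hlt h⁻¹ (G.inv_mem hh) H, fun x => ?_⟩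
        constructor
        · intro H'
          simpa using (hinv h hh _ _ H').symm
        · intro H'
          simpa using (hinv h⁻¹ (G.inv_mem hh) _ _ H').symm
      · exact ⟨h, hh, H, fun _ => Iff.rfl⟩
    have hest : π (e s) < π (t α) := by
      have := hlt e he hst
      rwa [(heS _).mpr htfix] at this
    have hesS : π (h (e s)) ≠ π (e s) := by
      rw [Ne, ← heS]
      exact (hlt e he hse).ne'
    obtain ⟨z, hz, hzs⟩ : ∃ z ∈ D (e s), z ∉ D s := by
      by_contra! hcon
      exact hse.ne (Dinj _ _ (Set.Subset.antisymm (Dmono hse.le) hcon))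
    have hzz : π z < π (e z) := by
      by_contra! hcon
      apply hzs
      have : e z ∈ D (e s) := by
        obtain ⟨u, hu, h1, h2⟩ := hz
        exact ⟨u, hu, h1, hcon.trans h2⟩
      simpa using Dequi e⁻¹ (G.inv_mem he) _ _ this
    have hzS : π (h z) ≠ π z := fun H => hzz.ne' ((heS z).mpr H)
    have hz1 : π z < π (t (h α)) := by
      obtain ⟨u, hu, h1, h2⟩ := hz
      exact h2.trans_lt (bound _ hesS hest u hu h1)
    have hz0 : π z < π (t α) := by
      by_contra! hcon
      have H := hinv t⁻¹ (G.inv_mem ht) _ _ (hdisj z hzS)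
      have H1 := hlt t⁻¹ (G.inv_mem ht) hz1
      have H2 := hle h hh (hle t⁻¹ (G.inv_mem ht) hcon)
      rw [RelIso.inv_apply_self] at H H1 H2
      exact (H1.trans_le H2).ne' H
    refine ⟨z, hzS, hz0, ?_⟩
    by_contra! hcon
    apply hzs
    obtain ⟨u, hu, h1, h2⟩ := hp
    exact ⟨u, hu, h1, hcon.le.trans h2⟩
  let R : Ω → Set Ω := fun y => {z | ∀ M : Set Ω, (∀ a ∈ M, ∀ b, π b ≤ π a → b ∈ M) →
    (∀ a ∈ M, D a ⊆ M) → y ∈ M → z ∈ M}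
  have hRc : IsConvexCongruence G (fun y y' => R y = R y') := by
    refine isConvexCongruence_of_equivariant ?_ ?_
    · intro y y' hyy z hz M hM hMD hy
      exact hz M hM hMD (hM _ hy _ (hπ hyy))
    · intro g hg y z hz M hM hMD hy
      exact hz {x | g x ∈ M} (fun a ha b hb => hM _ ha _ (hle g hg hb))
        (fun a ha b hb => hMD _ ha (Dequi g hg _ _ hb)) hy
  have hRα : R α = R (h α) := by
    apply Set.Subset.antisymm
    · intro z hz M hM hMD hy
      exact hz M hM hMD (hM _ hy _ hα.le)
    · intro z hz M hM hMD hy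
      exact hz M hM hMD (hMD _ hy ⟨1, G.one_mem, le_rfl, le_rfl⟩)
  have hRt : R α = R (t α) := hprim _ hRc _ _ hα.ne hRα
  have hmem : t α ∈ R α := by
    rw [hRt]
    exact fun _ _ _ H => H
  obtain ⟨s, -, hst, hts⟩ := hmem L
    (fun a ⟨s, h1, h2, h3⟩ b hb => ⟨s, h1, h2, hb.trans h3⟩) Lclosed ⟨α, hα.ne', htα, le_rfl⟩
  exact hst.not_ge hts

/-- The convex congruences not relating `α` and `β` have a largest one. -/
theorem isConvexCongruence_iSup_not_rel (htrans : IsTransitive G) {α β : Ω} (hne : α ≠ β) :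
    IsConvexCongruence G (fun x y => ∃ c, IsConvexCongruence G c ∧ ¬ c α β ∧ c x y) := by
  refine ⟨⟨fun x => ⟨_, isConvexCongruence_eq, hne, rfl⟩, ?_, ?_⟩, ?_, ?_⟩
  · rintro x y ⟨c, hc, h1, h2⟩
    exact ⟨c, hc, h1, hc.1.symm h2⟩
  · rintro x y z ⟨c, hc, h1, h2⟩ ⟨d, hd, h3, h4⟩
    rcases relLe_total htrans hc hd with H | H
    · exact ⟨d, hd, h3, hd.1.trans (H _ _ h2) h4⟩
    · exact ⟨c, hc, h1, hc.1.trans h2 (H _ _ h4)⟩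
  · rintro x y z ⟨c, hc, h1, h2⟩ hxy hyz
    exact ⟨c, hc, h1, hc.2.1 x y z h2 hxy hyz⟩
  · rintro g hg x y ⟨c, hc, h1, h2⟩
    exact ⟨c, hc, h1, hc.2.2 g hg x y h2⟩

/-- If `h` and its conjugate by `t` have disjoint supports, where `t` preserves the block
generated by `α` and `hα`, then some translate of a pair `(β, hβ)` meets both supports. -/
theorem exists_translate_meets_both (hlat : SublatticeClosed G) (htrans : IsTransitive G)
    {h t : Ω ≃o Ω} (hh : h ∈ G) (ht : t ∈ G) {α : Ω} (hα : h α ≠ α)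
    (htα : Vcong G α (h α) α (t α)) (hdisj : ∀ x, h x ≠ x → aconj h t⁻¹ x = x) :
    ∃ u ∈ G, ∃ β, (h (u β) ≠ u β ∧ aconj h t⁻¹ (u (h β)) ≠ u (h β)) ∨
      (aconj h t⁻¹ (u β) ≠ u β ∧ h (u (h β)) ≠ u (h β)) := by
  have hr := isConvexCongruence_iSup_not_rel (G := G) htrans hα.symm
  obtain ⟨π, hπ, hker⟩ := hr.exists_monotone
  have hinv : ∀ g ∈ G, ∀ x y, π x = π y → π (g x) = π (g y) := by
    intro g hg x y H
    rw [hker] at H ⊢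
    exact hr.2.2 g hg x y H
  have hπα : π α ≠ π (h α) := by
    rw [Ne, hker]
    rintro ⟨c, -, h1, h2⟩
    exact h1 h2
  have hprim : ∀ c, IsConvexCongruence G c → ∀ x y, π x ≠ π y → c x y → c α (t α) := by
    intro c hc x y hxy hcxy
    refine htα c hc ?_
    by_contra hcon
    exact hxy ((hker x y).mpr ⟨c, hc, hcon, hcxy⟩)
  have hdisjπ : ∀ x, π (h x) ≠ π x → π (t (h (t⁻¹ x))) = π x := fun x hx =>
    congrArg π (by simpa [aconj_apply] using hdisj x fun H => hx (by rw [H]))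
  have hπt : π α ≠ π (t α) := by
    intro H
    have h1 := hinv t⁻¹ (G.inv_mem ht) _ _ H
    rw [RelIso.inv_apply_self] at h1
    have h2 := hinv t ht _ _ (hinv h hh _ _ h1)
    rw [hdisjπ α hπα.symm, H] at h2
    exact hπα (by simpa using hinv t⁻¹ (G.inv_mem ht) _ _ h2)
  have hmov : ∀ g ∈ G, ∀ {x y}, π x = π y → π (g y) ≠ π y → g x ≠ x := by
    intro g hg x y hxy hy H
    exact hy (by rw [← hinv g hg _ _ hxy, H, hxy])
  have core : ∀ e ∈ G, π α < π (e α) →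
      (∀ x, π (e x) ≠ π x → π (t (e (t⁻¹ x))) = π x) →
      ∃ u ∈ G, (e (u α) ≠ u α ∧ t (e (t⁻¹ (u (e α)))) ≠ u (e α)) ∨
        (t (e (t⁻¹ (u α))) ≠ u α ∧ e (u (e α)) ≠ u (e α)) := by
    intro e he hαe hd
    have hlt : ∀ g ∈ G, ∀ {x y}, π x < π y → π (g x) < π (g y) := by
      intro g hg x y hxy
      refine lt_of_le_of_ne (hπ (g.monotone (hπ.reflect_lt hxy).le)) fun H => hxy.ne ?_
      simpa using hinv g⁻¹ (G.inv_mem hg) _ _ H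
    have hee := hlt e he hαe
    have hconj := G.mul_mem (G.mul_mem ht he) (G.inv_mem ht)
    rcases lt_or_gt_of_ne hπt with hlt' | hlt'
    · obtain ⟨u, hu, h1, h2⟩ :=
        exists_translate_between hlat htrans hπ hinv he ht hαe hlt' hprim hd
      refine ⟨u, hu, Or.inl ⟨fun H => h1 (by rw [H]), hmov _ hconj h2 ?_⟩⟩
      simpa using (hlt t ht hee).ne'
    · obtain ⟨u, hu, h1, h2⟩ :=
        exists_translate_between (h := t * e * t⁻¹) (t := t⁻¹) (α := t α) hlat htrans hπ hinv
          hconj (G.inv_mem ht) (by simpa using hlt t ht hαe) (by simpa using hlt')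
          (fun c hc x y hxy hcxy => by simpa using hc.1.symm (hprim c hc x y hxy hcxy))
          (fun x hx => by
            by_contra hcon
            exact hx (by simpa using hd x (by simpa using hcon)))
      refine ⟨u * t, G.mul_mem hu ht, Or.inr ⟨fun H => h1 (by simpa using congrArg π H), ?_⟩⟩
      refine hmov e he (y := e α) ?_ hee.ne'
      simpa using h2
  have conj_apply : ∀ x, aconj h t⁻¹ x = t (h (t⁻¹ x)) := fun x => by simp [aconj_apply]
  have inv_fix : ∀ (g : Ω ≃o Ω) (x : Ω), g⁻¹ x ≠ x → g x ≠ x := fun g x hx H =>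
    hx (by conv_lhs => rw [← H, RelIso.inv_apply_self])
  simp only [conj_apply]
  rcases lt_or_gt_of_ne hπα with hlt | hlt
  · obtain ⟨u, hu, H⟩ := core h hh hlt hdisjπ
    exact ⟨u, hu, α, H⟩
  · have hαi : π α < π (h⁻¹ α) := by
      refine lt_of_le_of_ne (hπ ?_) fun H => hπα ?_
      · simpa using h⁻¹.monotone (hπ.reflect_lt hlt).le
      · simpa using (hinv h hh _ _ H).symm
    have inv_conj : ∀ x, t (h⁻¹ (t⁻¹ x)) ≠ x → t (h (t⁻¹ x)) ≠ x := by
      intro x hx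
      simpa using inv_fix (t * h * t⁻¹) x (by simpa [mul_assoc] using hx)
    obtain ⟨u, hu, H⟩ := core h⁻¹ (G.inv_mem hh) hαi (fun x hx => by
      have h1 : h x ≠ x := inv_fix h x fun H => hx (by rw [H])
      have h2 := hdisj x h1
      rw [conj_apply] at h2
      by_contra hcon
      exact inv_conj x (fun H => hcon (by rw [H])) h2)
    refine ⟨u, hu, h⁻¹ α, ?_⟩
    rw [RelIso.apply_inv_self]
    rcases H with ⟨h1, h2⟩ | ⟨h1, h2⟩
    · exact Or.inr ⟨inv_conj _ h2, inv_fix _ _ h1⟩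
    · exact Or.inl ⟨inv_fix _ _ h2, inv_conj _ h1⟩

end Interpolation

section DoubleCentralizer

variable {G : Subgroup (Ω ≃o Ω)}

theorem aconj_mem {h g : Ω ≃o Ω} (hh : h ∈ G) (hg : g ∈ G) : aconj h g ∈ G :=
  G.mul_mem (G.mul_mem (G.inv_mem hg) hh) hg

theorem exists_noncommuting_of_block (hlat : SublatticeClosed G) (htrans : IsTransitive G)
    (habund : Abundant G) (hnomin : SpineNoMin G) {h t : Ω ≃o Ω} (hh : h ∈ G) (ht : t ∈ G)
    {α : Ω} (hα : h α ≠ α) (htα : Vcong G α (h α) α (t α)) :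
    ∃ a ∈ Xset G h, ∃ b ∈ Xset G (aconj h t⁻¹), pcomm a b ≠ 1 := by
  by_contra! hcon
  have hcomm : ∀ a ∈ Xset G h, ∀ b ∈ Xset G (aconj h t⁻¹), a * b = b * a := by
    intro a ha b hb
    by_contra hne
    exact pcomm_ne_one_of_mul_ne hne (hcon a ha b hb)
  have hh' : aconj h t⁻¹ ∈ G := aconj_mem hh (G.inv_mem ht)
  have fix₁ : ∀ p, h p ≠ p → ∀ b ∈ Xset G (aconj h t⁻¹), b p = p := fun p hp b hb =>
    fixes_of_commute_Xset htrans habund hnomin hh hp fun a ha => hcomm a ha b hb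
  have fix₂ : ∀ p, aconj h t⁻¹ p ≠ p → ∀ a ∈ Xset G h, a p = p := fun p hp a ha =>
    fixes_of_commute_Xset htrans habund hnomin hh' hp fun b hb => (hcomm a ha b hb).symm
  have commutator_fix : ∀ (k j : Ω ≃o Ω) (p : Ω), k p = p →
      pcomm k⁻¹ j p = p → k (j p) = j p := by
    intro k j p hk H
    have hk' : k⁻¹ p = p := by conv_lhs => rw [← hk, RelIso.inv_apply_self]
    have h1 : k (j⁻¹ (k⁻¹ (j p))) = p := by simpa [pcomm] using H
    have h2 := congrArg (fun z => k (j (k⁻¹ z))) h1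
    simp only [RelIso.inv_apply_self, RelIso.apply_inv_self, hk'] at h2
    exact h2.symm
  have hdisj : ∀ x, h x ≠ x → aconj h t⁻¹ x = x := by
    intro x hx
    by_contra hx'
    obtain ⟨q, hq⟩ : ∃ q, q ≠ x ∧ q ≠ h x ∧ q ≠ h⁻¹ x := by
      rcases lt_or_gt_of_ne hx with H | H
      · have H' : x < h⁻¹ x := by simpa using h⁻¹.strictMono H
        exact ⟨h (h x), ((h.strictMono H).trans H).ne, (h.strictMono H).ne,
          ((h.strictMono H).trans (H.trans H')).ne⟩
      · have H' : h⁻¹ x < x := by simpa using h⁻¹.strictMono H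
        exact ⟨h (h x), (H.trans (h.strictMono H)).ne', (h.strictMono H).ne',
          (H'.trans (H.trans (h.strictMono H))).ne'⟩
    obtain ⟨y, hy, hyx, -⟩ :=
      exists_mem_Xset_move htrans habund hnomin hx hq.1 hq.2.1 hq.2.2 hh
    exact hyx (fix₂ x hx' y hy)
  obtain ⟨u, hu, β, H⟩ := exists_translate_meets_both hlat htrans hh ht hα htα hdisj
  have hj : aconj h u⁻¹ (u β) = u (h β) := by simp [aconj_apply]
  rcases H with ⟨h1, h2⟩ | ⟨h1, h2⟩
  · refine h2 ?_
    have hmem : pcomm (aconj h t⁻¹)⁻¹ (aconj h u⁻¹) ∈ Xset G (aconj h t⁻¹) :=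
      ⟨t * u⁻¹, G.mul_mem ht (G.inv_mem hu), by unfold aconj; group⟩
    have := commutator_fix _ _ _ (hdisj _ h1) (fix₁ _ h1 _ hmem)
    rwa [hj] at this
  · refine h2 ?_
    have hfix : h (u β) = u β := by
      by_contra hne
      exact h1 (hdisj _ hne)
    have hmem : pcomm h⁻¹ (aconj h u⁻¹) ∈ Xset G h := ⟨u⁻¹, G.inv_mem hu, rfl⟩
    have := commutator_fix _ _ _ hfix (fix₂ _ h1 _ hmem)
    rwa [hj] at this

/-- If the support of `h` lies in an o-block, so do the supports of the elements of `X_h`. -/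
theorem Xset_fix_of_not_rel {c : Ω → Ω → Prop} (hc : IsConvexCongruence G c) {h : Ω ≃o Ω}
    {δ : Ω} (hfix : ∀ z, ¬ c δ z → h z = z) {x : Ω ≃o Ω} (hx : x ∈ Xset G h)
    {z : Ω} (hz : ¬ c δ z) : x z = z := by
  obtain ⟨w, hw, rfl⟩ := hx
  have hmem : ∀ y, c δ y → c δ (h y) := by
    intro y hy
    by_contra hcon
    have := hfix _ hcon
    rw [h.injective this] at hcon
    exact hcon hy
  have key : ¬ c δ (aconj h w z) := by
    intro hj
    have hwz : c δ (w z) := by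
      by_contra hcon
      rw [aconj_apply, hfix _ hcon, RelIso.inv_apply_self] at hj
      exact hz hj
    have h1 : c (w (aconj h w z)) (w z) := by
      rw [aconj_apply, RelIso.apply_inv_self]
      exact hc.1.trans (hc.1.symm (hmem _ hwz)) hwz
    rw [hc.apply_iff hw] at h1
    exact hz (hc.1.trans hj h1)
  have hinv : ∀ y, ¬ c δ y → h⁻¹ y = y := fun y hy => by
    conv_lhs => rw [← hfix y hy, RelIso.inv_apply_self]
  have : pcomm h⁻¹ (aconj h w) z = h ((aconj h w)⁻¹ (h⁻¹ (aconj h w z))) := by simp [pcomm]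
  rw [this, hinv _ key, RelIso.inv_apply_self, hfix z hz]

theorem cent_ptStab_eq_rst (htrans : IsTransitive G) (habund : Abundant G)
    (hnomin : SpineNoMin G) {κ : Ω → Ω → Prop} (hκ : SpineMem G κ) (δ : Ω) :
    cent G (ptStab G {γ | κ δ γ}) = rst G {γ | κ δ γ} := by
  have hκc := hκ.isConvexCongruence
  ext f
  constructor
  · rintro ⟨hf, hcomm⟩
    refine ⟨hf, fun β hβ => ?_⟩
    by_contra hβΔ
    obtain ⟨c₁, hc₁, hr⟩ := exists_spineMem_not_rel hnomin (Ne.symm hβ)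
    obtain ⟨c, hc, hle₁, hle₂⟩ := exists_spineMem_le_le htrans hc₁ hκ
    obtain ⟨k, hk, hkβ, hkfix⟩ := exists_mem_move htrans habund hc β
    have hkm : k ∈ ptStab G {γ | κ δ γ} :=
      ⟨hk, fun z hz => hkfix z fun H => hβΔ (hκc.1.trans hz (hκc.1.symm (hle₂ _ _ H)))⟩
    have h1 := DFunLike.congr_fun (hcomm k hkm) β
    simp only [RelIso.mul_apply] at h1
    rw [hkfix _ fun H => hr (hle₁ _ _ H)] at h1
    exact hkβ (f.injective h1).symm
  · rintro ⟨hf, hsupp⟩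
    refine ⟨hf, fun k hk => mul_comm_of_disjoint_supp fun z => ?_⟩
    by_cases hz : κ δ z
    · exact Or.inl (hk.2 z hz)
    · right
      by_contra hne
      exact hz (hsupp hne)

theorem cent_Wset_eq_ptStab (hlat : SublatticeClosed G) (htrans : IsTransitive G)
    (habund : Abundant G) (hnomin : SpineNoMin G) {h : Ω ≃o Ω} {α : Ω} (hα : h α ≠ α)
    (hh : h ∈ rst G {γ | Vcong G α (h α) α γ}) :
    cent G (Wset G h) = ptStab G {γ | Vcong G α (h α) α γ} := by
  obtain ⟨hhG, hsupp⟩ := hh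
  set κ := Vcong G α (h α) with hκ
  have hκc : IsConvexCongruence G κ := isConvexCongruence_Vcong α (h α)
  have hfix : ∀ z, ¬ κ α z → h z = z := by
    intro z hz
    by_contra hne
    exact hz (hsupp hne)
  ext f
  constructor
  · rintro ⟨hf, hcomm⟩
    refine ⟨hf, fun β hβ => ?_⟩
    obtain ⟨g, hg, hgβ⟩ := htrans β α
    have hgα : κ α (g⁻¹ α) := by
      rw [← hgβ, RelIso.inv_apply_self, hgβ]
      exact hβ
    have hnc := exists_noncommuting_of_block hlat htrans habund hnomin hhG (G.inv_mem hg) hα hgα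
    rw [inv_inv] at hnc
    have hmove : aconj h g β ≠ β := by
      rw [aconj_apply, hgβ]
      intro H
      exact hα (by simpa [hgβ] using congrArg g H)
    exact fixes_of_commute_Xset htrans habund hnomin (aconj_mem hhG hg) hmove
      fun y hy => hcomm y ⟨g, hg, hnc, hy⟩
  · rintro ⟨hf, hffix⟩
    refine ⟨hf, ?_⟩
    rintro x ⟨g, hg, ⟨a, ha, b, hb, hab⟩, hx⟩
    have hshift : ∀ w, κ (g⁻¹ α) w ↔ κ α (g w) := fun w => by
      rw [← hκc.apply_iff hg, RelIso.apply_inv_self]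
    have hfix' : ∀ z, ¬ κ (g⁻¹ α) z → aconj h g z = z := by
      intro z hz
      rw [hshift] at hz
      rw [aconj_apply, hfix _ hz, RelIso.inv_apply_self]
    have hrel : κ α (g⁻¹ α) := by
      by_contra hcon
      refine hab (pcomm_eq_one_of_mul_eq (mul_comm_of_disjoint_supp fun z => ?_))
      by_cases hz : κ α z
      · exact Or.inr (Xset_fix_of_not_rel hκc hfix' hb
          fun H => hcon (hκc.1.trans hz (hκc.1.symm H)))
      · exact Or.inl (Xset_fix_of_not_rel hκc hfix ha hz)
    refine mul_comm_of_disjoint_supp fun z => ?_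
    by_cases hz : κ α z
    · exact Or.inr (hffix z hz)
    · exact Or.inl (Xset_fix_of_not_rel hκc hfix' hx fun H => hz (hκc.1.trans hrel H))

theorem cent2_Wset_eq_rst (hlat : SublatticeClosed G) (htrans : IsTransitive G)
    (habund : Abundant G) (hnomin : SpineNoMin G) {Δ : Set Ω} (hΔ : InT G Δ) {h : Ω ≃o Ω}
    (hQ : h ∈ Qset G Δ) : cent2 G (Wset G h) = rst G Δ := by
  obtain ⟨hrst, α, hαΔ, hΔα⟩ := hQ
  have hα : h α ≠ α := by
    intro hfix
    obtain ⟨c, hc, δ, hδ⟩ := hΔ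
    have hcc := hc.isConvexCongruence
    obtain ⟨γ, hγα, hγ⟩ := hc.exists_ne_rel htrans α
    have hmem : γ ∈ Δ := by
      rw [hδ] at hαΔ ⊢
      exact hcc.1.trans hαΔ hγ
    rw [hΔα, hfix] at hmem
    exact hγα (hmem Eq isConvexCongruence_eq rfl).symm
  subst hΔα
  rw [cent2, cent_Wset_eq_ptStab hlat htrans habund hnomin hα hrst]
  exact cent_ptStab_eq_rst htrans habund hnomin ⟨α, h α, hα.symm, rfl⟩ α

end DoubleCentralizer

/-- (Corollary 4.4 of the paper.) -/
theorem double_centralizer_eq_rst {Ω : Type*} [LinearOrder Ω]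
    (G : Subgroup (Ω ≃o Ω)) (hlat : SublatticeClosed G)
    (htrans : IsTransitive G) (habund : Abundant G) (hnomin : SpineNoMin G)
    (Δ : Set Ω) (hΔ : InT G Δ) :
    (∀ h ∈ Qset G Δ, cent2 G (Wset G h) = rst G Δ) ∧
    ∀ h ∈ Qset G Δ, ∀ h' ∈ Qset G Δ,
      cent2 G (Wset G h) = cent2 G (Wset G h') := by
  have key : ∀ h ∈ Qset G Δ, cent2 G (Wset G h) = rst G Δ := fun _ hQ =>
    cent2_Wset_eq_rst hlat htrans habund hnomin hΔ hQ
  exact ⟨key, fun h hQ h' hQ' => (key h hQ).trans (key h' hQ').symm⟩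

end LPerm
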